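/- If β·σ·√(2π) ≥ 1 (i.e., β is at least the maximal slope of the map θ ↦ Φ((θ − μ)/σ)), then for every α ∈ ℝ and every μ ∈ ℝ the set S(α, β, μ, σ) has exactly one element. -/

import Mathlib

open Real MeasureTheory

/-- The standard normal cumulative distribution function
`Φ(z) = (1/√(2π)) ∫_{−∞}^{z} exp(−t²/2) dt`. -/
noncomputable def stdNormalCDF (z : ℝ) : ℝ :=
  (Real.sqrt (2 * Real.pi))⁻¹ * ∫ t in Set.Iic z, Real.exp (-t ^ 2 / 2)

/-- The equilibrium solution set `S(α, β, μ, σ) = {θ : α + β·θ = Φ((θ − μ)/σ)}`. -/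
def S (α β μ σ : ℝ) : Set ℝ :=
  {θ : ℝ | α + β * θ = stdNormalCDF ((θ - μ) / σ)}

theorem integrable_exp_neg_sq_div_two : Integrable fun t : ℝ => Real.exp (-t ^ 2 / 2) := by
  refine (integrable_exp_neg_mul_sq (b := 1 / 2) (by norm_num)).congr (.of_forall fun t => ?_)
  simp only
  ring_nf

theorem stdNormalCDF_sub (x y : ℝ) :
    stdNormalCDF y - stdNormalCDF x =
      (Real.sqrt (2 * Real.pi))⁻¹ * ∫ t in x..y, Real.exp (-t ^ 2 / 2) := by
  rw [stdNormalCDF, stdNormalCDF, ← mul_sub,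
    intervalIntegral.integral_Iic_sub_Iic integrable_exp_neg_sq_div_two.integrableOn
      integrable_exp_neg_sq_div_two.integrableOn]

theorem continuous_stdNormalCDF : Continuous stdNormalCDF := by
  have h : stdNormalCDF = fun z => stdNormalCDF 0 +
      (Real.sqrt (2 * Real.pi))⁻¹ * ∫ t in (0 : ℝ)..z, Real.exp (-t ^ 2 / 2) := by
    funext z
    rw [← stdNormalCDF_sub]
    ring
  rw [h]
  exact continuous_const.add (continuous_const.mul (intervalIntegral.continuous_primitive
    (fun _ _ => integrable_exp_neg_sq_div_two.intervalIntegrable) 0))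

theorem stdNormalCDF_nonneg (z : ℝ) : 0 ≤ stdNormalCDF z :=
  mul_nonneg (by positivity) (integral_nonneg fun _ => (Real.exp_pos _).le)

theorem stdNormalCDF_le_integral (z : ℝ) :
    stdNormalCDF z ≤ (Real.sqrt (2 * Real.pi))⁻¹ * ∫ t : ℝ, Real.exp (-t ^ 2 / 2) :=
  mul_le_mul_of_nonneg_left
    (setIntegral_le_integral integrable_exp_neg_sq_div_two
      (.of_forall fun _ => (Real.exp_pos _).le))
    (by positivity)

theorem integral_exp_neg_sq_div_two_lt {x y : ℝ} (hxy : x < y) :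
    ∫ t in x..y, Real.exp (-t ^ 2 / 2) < y - x := by
  have h : ∫ t in x..y, Real.exp (-t ^ 2 / 2) < ∫ _ in x..y, (1 : ℝ) := by
    refine intervalIntegral.integral_lt_integral_of_continuousOn_of_le_of_exists_lt hxy
      (by fun_prop) (by fun_prop) (fun t _ => ?_) ?_
    · rw [Real.exp_le_one_iff]
      nlinarith [sq_nonneg t]
    · obtain ⟨c, hc, hc0⟩ : ∃ c ∈ Set.Icc x y, c ≠ 0 := by
        rcases eq_or_ne x 0 with hx | hx
        · exact ⟨y, Set.right_mem_Icc.2 hxy.le, (hx ▸ hxy).ne'⟩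
        · exact ⟨x, Set.left_mem_Icc.2 hxy.le, hx⟩
      refine ⟨c, hc, ?_⟩
      rw [Real.exp_lt_one_iff]
      have := sq_pos_of_ne_zero hc0
      linarith
  simpa using h

theorem stdNormalCDF_sub_lt {x y : ℝ} (hxy : x < y) :
    stdNormalCDF y - stdNormalCDF x < (Real.sqrt (2 * Real.pi))⁻¹ * (y - x) := by
  rw [stdNormalCDF_sub]
  exact mul_lt_mul_of_pos_left (integral_exp_neg_sq_div_two_lt hxy) (by positivity)

theorem strictMono_sub_stdNormalCDF {β σ : ℝ} (hσ : 0 < σ)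
    (hslope : 1 ≤ β * σ * Real.sqrt (2 * Real.pi)) (α μ : ℝ) :
    StrictMono fun θ => α + β * θ - stdNormalCDF ((θ - μ) / σ) := by
  intro a b hab
  have hz : (a - μ) / σ < (b - μ) / σ := by gcongr
  have h := stdNormalCDF_sub_lt hz
  have hc : (Real.sqrt (2 * Real.pi))⁻¹ ≤ β * σ := by
    rwa [inv_le_iff_one_le_mul₀ (by positivity)]
  have hb := mul_le_mul_of_nonneg_right hc (sub_nonneg.2 hz.le)
  have he : β * σ * ((b - μ) / σ - (a - μ) / σ) = β * b - β * a := by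
    field_simp
    ring
  simp only
  linarith

/-- If `β·σ·√(2π) ≥ 1` (i.e. `β` is at least the maximal slope of
`θ ↦ Φ((θ − μ)/σ)`), then `S(α, β, μ, σ)` has exactly one element. -/
theorem stmt3 (β σ : ℝ) (hβ : 0 < β) (hσ : 0 < σ)
    (hslope : β * σ * Real.sqrt (2 * Real.pi) ≥ 1) :
    ∀ (α μ : ℝ), ∃! θ : ℝ, θ ∈ S α β μ σ := by
  intro α μ
  have hmono := strictMono_sub_stdNormalCDF hσ hslope α μ
  have hcont : Continuous fun θ => α + β * θ - stdNormalCDF ((θ - μ) / σ) :=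
    (by fun_prop : Continuous fun θ : ℝ => α + β * θ).sub
      (continuous_stdNormalCDF.comp (by fun_prop))
  set M := (Real.sqrt (2 * Real.pi))⁻¹ * ∫ t : ℝ, Real.exp (-t ^ 2 / 2)
  obtain ⟨θ, hθ⟩ := mem_range_of_exists_le_of_exists_ge (c := (0 : ℝ)) hcont
    ⟨-α / β, by
      have h := stdNormalCDF_nonneg ((-α / β - μ) / σ)
      rw [mul_div_cancel₀ _ hβ.ne']
      linarith⟩
    ⟨(M - α) / β, by
      have h := stdNormalCDF_le_integral (((M - α) / β - μ) / σ)
      rw [mul_div_cancel₀ _ hβ.ne']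
      linarith⟩
  exact ⟨θ, sub_eq_zero.1 hθ, fun η hη => hmono.injective ((sub_eq_zero.2 hη).trans hθ.symm)⟩
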